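/- arXiv:2301.00814 — 9 statements merged into one kernel-verified Lean document; each statement's English description precedes it below -/
import Mathlib

section
/- Let A, B, C be polynomials in the time-delay and time-advance operators (finite real linear combinations of monomials). Then the second-order commutator Δ₁ = [C, [A, B]] vanishes to first order in the rates: for every smooth φ : ℝ → ℝ and every t ∈ ℝ, the function F(s) = ((Δ₁)φ)(t), defined for all s in some neighborhood of 0, satisfies F(0) = 0 and F′(0) = 0. -/
namespace TDI

variable {ι : Type*}

/-- A signed letter: an index together with a sign
(`true` = time-delay operator, `false` = time-advance operator). -/
abbrev Letter (ι : Type*) := ι × Bool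

/-- A word: a monomial in the time-delay and time-advance operators. -/
abbrev Word (ι : Type*) := List (Letter ι)

/-- A polynomial: a finite real linear combination of monomials. -/
abbrev Poly (ι : Type*) := List (ℝ × Word ι)

/-- The time displacement performed by a single letter at expansion parameter `s`:
a time-delay acts by `t ↦ (1 - s·ℓ i)·t - L i`, a time-advance by its inverse map
`t ↦ (t + L i)/(1 - s·ℓ i)`. -/
noncomputable def letterMap (L l : ι → ℝ) (s : ℝ) (x : Letter ι) (t : ℝ) : ℝ :=
  if x.2 then (1 - s * l x.1) * t - L x.1 else (t + L x.1) / (1 - s * l x.1)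

/-- The total time displacement performed by a word `w = x₁ ⋯ xₙ`, so that the operator
`D_{x₁} ∘ ⋯ ∘ D_{xₙ}` is precomposition with this map. -/
noncomputable def wordMap (L l : ι → ℝ) (s : ℝ) : Word ι → ℝ → ℝ
  | [] => id
  | x :: w => wordMap L l s w ∘ letterMap L l s x

/-- The operator on functions associated to a word (monomial): precomposition with
`wordMap`. -/
noncomputable def wordOp (L l : ι → ℝ) (s : ℝ) (w : Word ι) (φ : ℝ → ℝ) : ℝ → ℝ :=
  φ ∘ wordMap L l s w

/-- The operator on functions associated to a polynomial: the corresponding real linear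
combination of the monomial operators. -/
noncomputable def polyOp (L l : ι → ℝ) (s : ℝ) (P : Poly ι) (φ : ℝ → ℝ) : ℝ → ℝ :=
  fun t => (P.map fun cw => cw.1 * wordOp L l s cw.2 φ t).sum

/-- The commutator `[P, Q] = P∘Q − Q∘P` of two operators on functions. -/
def comm (P Q : (ℝ → ℝ) → ℝ → ℝ) (φ : ℝ → ℝ) (t : ℝ) : ℝ :=
  P (Q φ) t - Q (P φ) t

end TDI

namespace TDI

theorem letterMap_deriv {ι : Type*} (L l : ι → ℝ) (x : Letter ι) :
    ∃ α β γ : ℝ, (∀ y, letterMap L l 0 x y = y + β) ∧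
      ∀ (u : ℝ → ℝ) (u' : ℝ), HasDerivAt u u' 0 →
        HasDerivAt (fun s => letterMap L l s x (u s)) (α * u 0 + γ + u') 0 := by
  obtain ⟨i, b⟩ := x
  have h1 : HasDerivAt (fun s : ℝ => 1 - s * l i) (-(l i)) 0 := by
    have := ((hasDerivAt_id (0:ℝ)).mul_const (l i)).const_sub 1
    simpa using this
  cases b
  · refine ⟨l i, L i, l i * L i, fun y => by simp [letterMap], fun u u' hu => ?_⟩
    have := (hu.add_const (L i)).div h1 (by simp)
    simp only [letterMap, Bool.false_eq_true, if_false]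
    refine HasDerivAt.congr_deriv this ?_
    simp
    ring
  · refine ⟨-l i, -L i, 0, fun y => by simp [letterMap, sub_eq_add_neg], fun u u' hu => ?_⟩
    have := (h1.mul hu).sub_const (L i)
    simp only [letterMap, if_true]
    refine HasDerivAt.congr_deriv this ?_
    simp

theorem wordMap_deriv {ι : Type*} (L l : ι → ℝ) (w : Word ι) :
    ∃ α β γ : ℝ, (∀ y, wordMap L l 0 w y = y + β) ∧
      ∀ (u : ℝ → ℝ) (u' : ℝ), HasDerivAt u u' 0 →
        HasDerivAt (fun s => wordMap L l s w (u s)) (α * u 0 + γ + u') 0 := by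
  induction w with
  | nil => exact ⟨0, 0, 0, fun y => by simp [wordMap], fun u u' hu => by simpa [wordMap] using hu⟩
  | cons x w ih =>
    obtain ⟨α, β, γ, h0, h⟩ := ih
    obtain ⟨α', β', γ', h0', h'⟩ := letterMap_deriv L l x
    refine ⟨α + α', β + β', α * β' + γ + γ', fun y => ?_, fun u u' hu => ?_⟩
    · simp only [wordMap, Function.comp, h0, h0']; ring
    · have := h _ _ (h' u u' hu)
      simp only [wordMap, Function.comp]
      refine this.congr_deriv ?_
      rw [h0']; ring

theorem polyOp_nil {ι : Type*} (L l : ι → ℝ) (s : ℝ) (φ : ℝ → ℝ) :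
    polyOp L l s [] φ = fun _ => 0 := by
  funext t; simp [polyOp]

theorem polyOp_cons {ι : Type*} (L l : ι → ℝ) (s : ℝ) (x : ℝ × Word ι) (P : Poly ι) (φ : ℝ → ℝ) :
    polyOp L l s (x :: P) φ = fun t => x.1 * φ (wordMap L l s x.2 t) + polyOp L l s P φ t := by
  funext t; simp [polyOp, wordOp]

theorem polyOp_zero {ι : Type*} (L l : ι → ℝ) (s : ℝ) (P : Poly ι) (t : ℝ) :
    polyOp L l s P (fun _ => 0) t = 0 := by
  simp [polyOp, wordOp]

theorem polyOp_add {ι : Type*} (L l : ι → ℝ) (s : ℝ) (P : Poly ι) (f g : ℝ → ℝ) (t : ℝ) :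
    polyOp L l s P (fun y => f y + g y) t = polyOp L l s P f t + polyOp L l s P g t := by
  induction P with
  | nil => simp [polyOp_nil]
  | cons x P ih => simp only [polyOp_cons, ih]; ring

theorem polyOp_sub {ι : Type*} (L l : ι → ℝ) (s : ℝ) (P : Poly ι) (f g : ℝ → ℝ) (t : ℝ) :
    polyOp L l s P (fun y => f y - g y) t = polyOp L l s P f t - polyOp L l s P g t := by
  induction P with
  | nil => simp [polyOp_nil]
  | cons x P ih => simp only [polyOp_cons, ih]; ring

/-- The double commutator. -/
noncomputable def dbl {ι : Type*} (L l : ι → ℝ) (A B C : Poly ι) (φ : ℝ → ℝ) (t s : ℝ) : ℝ :=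
  comm (polyOp L l s C) (comm (polyOp L l s A) (polyOp L l s B)) φ t

theorem dbl_eq {ι : Type*} (L l : ι → ℝ) (A B C : Poly ι) (φ : ℝ → ℝ) (t s : ℝ) :
    dbl L l A B C φ t s =
      polyOp L l s C (polyOp L l s A (polyOp L l s B φ)) t
      - polyOp L l s C (polyOp L l s B (polyOp L l s A φ)) t
      - (polyOp L l s A (polyOp L l s B (polyOp L l s C φ)) t
      - polyOp L l s B (polyOp L l s A (polyOp L l s C φ)) t) := by
  rw [← polyOp_sub]; rfl

theorem polyOp_cons_fun {ι : Type*} (L l : ι → ℝ) (s : ℝ) (x : ℝ × Word ι) (P : Poly ι)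
    (φ : ℝ → ℝ) :
    polyOp L l s (x :: P) φ = fun t => polyOp L l s [x] φ t + polyOp L l s P φ t := by
  funext t; simp [polyOp, wordOp]

theorem polyOp_add_fun {ι : Type*} (L l : ι → ℝ) (s : ℝ) (P : Poly ι) (f g : ℝ → ℝ) :
    polyOp L l s P (fun y => f y + g y) = fun t => polyOp L l s P f t + polyOp L l s P g t :=
  funext fun _ => polyOp_add ..

theorem polyOp_zero_fun {ι : Type*} (L l : ι → ℝ) (s : ℝ) (P : Poly ι) :
    polyOp L l s P (fun _ => 0) = fun _ => 0 :=
  funext fun _ => polyOp_zero ..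

theorem dbl_word {ι : Type*} (L l : ι → ℝ) (a b c : ℝ × Word ι) (φ : ℝ → ℝ)
    (hφ : Differentiable ℝ φ) (t : ℝ) :
    dbl L l [a] [b] [c] φ t 0 = 0 ∧ HasDerivAt (dbl L l [a] [b] [c] φ t) 0 0 := by
  obtain ⟨ra, a⟩ := a
  obtain ⟨rb, b⟩ := b
  obtain ⟨rc, c⟩ := c
  obtain ⟨αa, βa, γa, ha0, ha⟩ := wordMap_deriv L l a
  obtain ⟨αb, βb, γb, hb0, hb⟩ := wordMap_deriv L l b
  obtain ⟨αc, βc, γc, hc0, hc⟩ := wordMap_deriv L l c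
  have key : dbl L l [(ra, a)] [(rb, b)] [(rc, c)] φ t = fun s => ra * rb * rc *
      (φ (wordMap L l s b (wordMap L l s a (wordMap L l s c t)))
      - φ (wordMap L l s a (wordMap L l s b (wordMap L l s c t)))
      - (φ (wordMap L l s c (wordMap L l s b (wordMap L l s a t)))
      - φ (wordMap L l s c (wordMap L l s a (wordMap L l s b t))))) := by
    funext s
    rw [dbl_eq]
    simp only [polyOp_cons, polyOp_nil]
    ring
  have ht := hasDerivAt_const (0:ℝ) t
  have e : ∀ (u : ℝ → ℝ) (u' : ℝ), HasDerivAt u u' 0 → u 0 = t + βa + βb + βc →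
      HasDerivAt (fun s => φ (u s)) (deriv φ (t + βa + βb + βc) * u') 0 := by
    intro u u' hu h0
    have := (hφ (u 0)).hasDerivAt.comp 0 hu
    rw [h0] at this
    exact this
  have h1 := e _ _ (hb _ _ (ha _ _ (hc _ _ ht))) (by simp only [ha0, hb0, hc0]; ring)
  have h2 := e _ _ (ha _ _ (hb _ _ (hc _ _ ht))) (by simp only [ha0, hb0, hc0]; ring)
  have h3 := e _ _ (hc _ _ (hb _ _ (ha _ _ ht))) (by simp only [ha0, hb0, hc0])
  have h4 := e _ _ (hc _ _ (ha _ _ (hb _ _ ht))) (by simp only [ha0, hb0, hc0]; ring)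
  rw [key]
  constructor
  · simp only [ha0, hb0, hc0]
    ring_nf
  · refine (((h1.sub h2).sub (h3.sub h4)).const_mul (ra * rb * rc)).congr_deriv ?_
    simp only [ha0, hb0, hc0]
    ring

theorem good_add {f g h : ℝ → ℝ} (e : ∀ s, f s = g s + h s)
    (hg : g 0 = 0 ∧ HasDerivAt g 0 0) (hh : h 0 = 0 ∧ HasDerivAt h 0 0) :
    f 0 = 0 ∧ HasDerivAt f 0 0 := by
  obtain rfl : f = fun s => g s + h s := funext e
  exact ⟨by simp [hg.1, hh.1], (hg.2.add hh.2).congr_deriv (add_zero 0)⟩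

theorem good_zero {f : ℝ → ℝ} (e : ∀ s, f s = 0) : f 0 = 0 ∧ HasDerivAt f 0 0 := by
  obtain rfl : f = fun _ => 0 := funext e
  exact ⟨rfl, hasDerivAt_const _ _⟩

theorem dbl_good {ι : Type*} (L l : ι → ℝ) (A B C : Poly ι) (φ : ℝ → ℝ)
    (hφ : Differentiable ℝ φ) (t : ℝ) :
    dbl L l A B C φ t 0 = 0 ∧ HasDerivAt (dbl L l A B C φ t) 0 0 := by
  induction A with
  | nil => exact good_zero fun s => by simp [dbl_eq, polyOp_nil, polyOp_zero_fun]
  | cons a A ihA =>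
    refine good_add (g := dbl L l [a] B C φ t) (fun s => ?_) ?_ ihA
    · simp only [dbl_eq, polyOp_cons_fun L l s a A, polyOp_add_fun]; ring
    clear ihA
    induction B with
    | nil => exact good_zero fun s => by simp [dbl_eq, polyOp_nil, polyOp_zero_fun]
    | cons b B ihB =>
      refine good_add (g := dbl L l [a] [b] C φ t) (fun s => ?_) ?_ ihB
      · simp only [dbl_eq, polyOp_cons_fun L l s b B, polyOp_add_fun]; ring
      clear ihB
      induction C with
      | nil => exact good_zero fun s => by simp [dbl_eq, polyOp_nil, polyOp_zero_fun]
      | cons c C ihC =>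
        refine good_add (g := dbl L l [a] [b] [c] φ t) (fun s => ?_) (dbl_word L l a b c φ hφ t) ihC
        simp only [dbl_eq, polyOp_cons_fun L l s c C, polyOp_add_fun]; ring

end TDI

/-- **Proposition 1.** For polynomials `A, B, C` in the time-delay and time-advance
operators, the second-order commutator `Δ₁ = [C, [A, B]]` vanishes to first order in the
rates: for every smooth `φ` and every `t`, the function `F(s) = ((Δ₁)φ)(t)` satisfies
`F(0) = 0` and `F′(0) = 0`. -/
theorem proposition1 (ι : Type*) [Fintype ι] (L l : ι → ℝ)
    (A B C : TDI.Poly ι) (φ : ℝ → ℝ) (hφ : ContDiff ℝ (⊤ : ℕ∞) φ) (t : ℝ) :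
    TDI.comm (TDI.polyOp L l 0 C)
        (TDI.comm (TDI.polyOp L l 0 A) (TDI.polyOp L l 0 B)) φ t = 0 ∧
      HasDerivAt
        (fun s : ℝ =>
          TDI.comm (TDI.polyOp L l s C)
            (TDI.comm (TDI.polyOp L l s A) (TDI.polyOp L l s B)) φ t)
        0 0 := by
  exact TDI.dbl_good L l A B C φ (hφ.differentiable (by simp)) t
end

section
/- Let A, B, C, E be polynomials in the time-delay and time-advance operators. Then the higher-order commutator Δ₃ = [E, [C, [A, B]]] vanishes to first order in the rates: for every smooth φ : ℝ → ℝ and every t ∈ ℝ, the function F(s) = ((Δ₃)φ)(t), defined for all s in some neighborhood of 0, satisfies F(0) = 0 and F′(0) = 0. -/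
namespace TDI

/-- Every word acts by an affine map whose coefficients are differentiable at `s = 0`. -/
theorem letter_affine {ι : Type*} (L l : ι → ℝ) (x : Letter ι) :
    ∃ (a b : ℝ → ℝ) (α β : ℝ), (∀ s t, letterMap L l s x t = a s * t + b s) ∧ a 0 = 1 ∧
      HasDerivAt a α 0 ∧ HasDerivAt b β 0 := by
  have h1 : HasDerivAt (fun s : ℝ => 1 - s * l x.1) (-l x.1) 0 := by
    simpa using ((hasDerivAt_id (0 : ℝ)).mul_const (l x.1)).const_sub 1
  obtain ⟨i, e⟩ := x
  cases e
  · have h2 := h1.fun_inv (by simp)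
    refine ⟨_, _, _, _, ?_, ?_, h2, h2.const_mul (L i)⟩
    · intro s t
      simp only [letterMap, Bool.false_eq_true, if_false]
      ring
    · simp
  · refine ⟨_, fun _ => -L i, _, 0, ?_, ?_, h1, hasDerivAt_const _ _⟩
    · intro s t
      simp only [letterMap, if_true]
      ring
    · simp

theorem word_affine {ι : Type*} (L l : ι → ℝ) (w : Word ι) :
    ∃ (a b : ℝ → ℝ) (α β : ℝ), (∀ s t, wordMap L l s w t = a s * t + b s) ∧ a 0 = 1 ∧
      HasDerivAt a α 0 ∧ HasDerivAt b β 0 := by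
  induction w with
  | nil =>
    exact ⟨fun _ => 1, fun _ => 0, 0, 0, by simp [wordMap], rfl,
      hasDerivAt_const _ _, hasDerivAt_const _ _⟩
  | cons x w ih =>
    obtain ⟨a, b, α, β, h, h0, ha, hb⟩ := ih
    obtain ⟨a', b', α', β', h', h0', ha', hb'⟩ := letter_affine L l x
    refine ⟨fun s => a s * a' s, fun s => a s * b' s + b s, _, _, ?_, ?_,
      ha.fun_mul ha', (ha.fun_mul hb').fun_add hb⟩
    · intro s t
      simp only [wordMap, Function.comp, h, h']
      ring
    · simp [h0, h0']

/-- The word operator as a linear endomorphism. -/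
noncomputable def wordEnd {ι : Type*} (L l : ι → ℝ) (s : ℝ) (w : Word ι) :
    Module.End ℝ (ℝ → ℝ) := LinearMap.funLeft ℝ ℝ (wordMap L l s w)

theorem polyOp_eq {ι : Type*} (L l : ι → ℝ) (s : ℝ) (P : Poly ι) :
    polyOp L l s P =
      ⇑(∑ i : Fin P.length, (P.get i).1 • wordEnd L l s (P.get i).2) := by
  funext φ t
  simp only [polyOp, LinearMap.sum_apply, Finset.sum_apply, LinearMap.smul_apply, Pi.smul_apply,
    smul_eq_mul, wordEnd, LinearMap.funLeft_apply, wordOp, Function.comp]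
  exact (Fin.sum_univ_fun_getElem P
    (fun cw : ℝ × Word ι => cw.1 * φ (wordMap L l s cw.2 t))).symm

theorem comm_eq (X Y : Module.End ℝ (ℝ → ℝ)) : comm X Y = ⇑(⁅X, Y⁆ : Module.End ℝ (ℝ → ℝ)) := rfl

theorem word_case {ι : Type*} (L l : ι → ℝ) (e c a b : Word ι) (φ : ℝ → ℝ)
    (hφ : Differentiable ℝ φ) (t : ℝ) :
    (⁅wordEnd L l 0 e, ⁅wordEnd L l 0 c, ⁅wordEnd L l 0 a, wordEnd L l 0 b⁆⁆⁆ :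
      Module.End ℝ (ℝ → ℝ)) φ t = 0 ∧
    HasDerivAt (fun s => (⁅wordEnd L l s e, ⁅wordEnd L l s c, ⁅wordEnd L l s a, wordEnd L l s b⁆⁆⁆ :
      Module.End ℝ (ℝ → ℝ)) φ t) 0 0 := by
  obtain ⟨p1, q1, α1, β1, h1, z1, hp1, hq1⟩ := word_affine L l e
  obtain ⟨p2, q2, α2, β2, h2, z2, hp2, hq2⟩ := word_affine L l c
  obtain ⟨p3, q3, α3, β3, h3, z3, hp3, hq3⟩ := word_affine L l a
  obtain ⟨p4, q4, α4, β4, h4, z4, hp4, hq4⟩ := word_affine L l b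
  simp only [LieRing.of_associative_ring_bracket, mul_sub, sub_mul, LinearMap.sub_apply,
    Pi.sub_apply, Module.End.mul_apply, wordEnd, LinearMap.funLeft_apply, h1, h2, h3, h4]
  constructor
  · simp only [z1, z2, z3, z4, one_mul]
    ring_nf
  · have key : ∀ {p q p' q' p'' q'' p''' q''' : ℝ → ℝ} {α β α' β' α'' β'' α''' β''' : ℝ},
        HasDerivAt p α 0 → HasDerivAt q β 0 → HasDerivAt p' α' 0 → HasDerivAt q' β' 0 →
        HasDerivAt p'' α'' 0 → HasDerivAt q'' β'' 0 →
        HasDerivAt p''' α''' 0 → HasDerivAt q''' β''' 0 →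
        p 0 = 1 → p' 0 = 1 → p'' 0 = 1 → p''' 0 = 1 →
        t + q1 0 + q2 0 + q3 0 + q4 0 = t + q 0 + q' 0 + q'' 0 + q''' 0 →
        HasDerivAt (fun s => φ (p s * (p' s * (p'' s * (p''' s * t + q''' s) + q'' s) + q' s) + q s))
          (deriv φ (t + q1 0 + q2 0 + q3 0 + q4 0) *
            (α * (t + q''' 0 + q'' 0 + q' 0) + α' * (t + q''' 0 + q'' 0) + α'' * (t + q''' 0)
              + α''' * t + β + β' + β'' + β''')) 0 := by
      intro p q p' q' p'' q'' p''' q''' α β α' β' α'' β'' α''' β''' a b a' b' a'' b'' a''' b'''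
        z z' z'' z''' hs
      have hin := (a.fun_mul ((a'.fun_mul ((a''.fun_mul
        ((a'''.mul_const t).fun_add b''')).fun_add b'')).fun_add b')).fun_add b
      have hd := (hφ (t + q1 0 + q2 0 + q3 0 + q4 0)).hasDerivAt
      have := HasDerivAt.comp_of_eq (0 : ℝ) hd hin (by rw [hs, z, z', z'', z''']; ring)
      refine this.congr_deriv ?_
      rw [z, z', z'', z''']
      ring
    refine HasDerivAt.congr_deriv (HasDerivAt.fun_sub (HasDerivAt.fun_sub (HasDerivAt.fun_sub
      (key hp4 hq4 hp3 hq3 hp2 hq2 hp1 hq1 z4 z3 z2 z1 (by ring)) (key hp3 hq3 hp4 hq4 hp2 hq2 hp1 hq1 z3 z4 z2 z1 (by ring)))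
      (HasDerivAt.fun_sub
      (key hp2 hq2 hp4 hq4 hp3 hq3 hp1 hq1 z2 z4 z3 z1 (by ring)) (key hp2 hq2 hp3 hq3 hp4 hq4 hp1 hq1 z2 z3 z4 z1 (by ring))))
      (HasDerivAt.fun_sub (HasDerivAt.fun_sub
      (key hp1 hq1 hp4 hq4 hp3 hq3 hp2 hq2 z1 z4 z3 z2 (by ring)) (key hp1 hq1 hp3 hq3 hp4 hq4 hp2 hq2 z1 z3 z4 z2 (by ring)))
      (HasDerivAt.fun_sub
      (key hp1 hq1 hp2 hq2 hp4 hq4 hp3 hq3 z1 z2 z4 z3 (by ring)) (key hp1 hq1 hp2 hq2 hp3 hq3 hp4 hq4 z1 z2 z3 z4 (by ring)))))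
      ?_
    ring

end TDI

/-- **Corollary 1 (first form).** For polynomials `A, B, C, E` in the time-delay and
time-advance operators, the higher-order commutator `Δ₃ = [E, [C, [A, B]]]` vanishes to
first order in the rates: for every smooth `φ` and every `t`, the function
`F(s) = ((Δ₃)φ)(t)` satisfies `F(0) = 0` and `F′(0) = 0`. -/
theorem corollary1_commutator (ι : Type*) [Fintype ι] (L l : ι → ℝ)
    (A B C E : TDI.Poly ι) (φ : ℝ → ℝ) (hφ : ContDiff ℝ (⊤ : ℕ∞) φ) (t : ℝ) :
    TDI.comm (TDI.polyOp L l 0 E)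
        (TDI.comm (TDI.polyOp L l 0 C)
          (TDI.comm (TDI.polyOp L l 0 A) (TDI.polyOp L l 0 B))) φ t = 0 ∧
      HasDerivAt
        (fun s : ℝ =>
          TDI.comm (TDI.polyOp L l s E)
            (TDI.comm (TDI.polyOp L l s C)
              (TDI.comm (TDI.polyOp L l s A) (TDI.polyOp L l s B))) φ t)
        0 0 := by
  have hd : Differentiable ℝ φ := hφ.differentiable (by simp)
  simp only [TDI.polyOp_eq, TDI.comm_eq]
  have e1 : ∀ (n : ℕ) (f : Fin n → Module.End ℝ (ℝ → ℝ)) (m : Module.End ℝ (ℝ → ℝ)),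
      ⁅∑ i, f i, m⁆ = ∑ i, ⁅f i, m⁆ := by
    intro n f m
    simp only [Ring.lie_def, Finset.sum_mul, Finset.mul_sum, Finset.sum_sub_distrib]
  have e2 : ∀ (n : ℕ) (f : Fin n → Module.End ℝ (ℝ → ℝ)) (m : Module.End ℝ (ℝ → ℝ)),
      ⁅m, ∑ i, f i⁆ = ∑ i, ⁅m, f i⁆ := by
    intro n f m
    simp only [Ring.lie_def, Finset.sum_mul, Finset.mul_sum, Finset.sum_sub_distrib]
  have e3 : ∀ (r : ℝ) (f m : Module.End ℝ (ℝ → ℝ)), ⁅r • f, m⁆ = r • ⁅f, m⁆ := by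
    intro r f m
    simp only [Ring.lie_def, smul_mul_assoc, mul_smul_comm, smul_sub]
  have e4 : ∀ (r : ℝ) (f m : Module.End ℝ (ℝ → ℝ)), ⁅f, r • m⁆ = r • ⁅f, m⁆ := by
    intro r f m
    simp only [Ring.lie_def, smul_mul_assoc, mul_smul_comm, smul_sub]
  simp only [e1, e2, e3, e4,
    LinearMap.sum_apply, Finset.sum_apply, LinearMap.smul_apply, Pi.smul_apply, smul_eq_mul]
  constructor
  · simp only [(TDI.word_case L l _ _ _ _ φ hd t).1, mul_zero, Finset.sum_const_zero]
  · have := fun e c a b => (TDI.word_case L l e c a b φ hd t).2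
    refine HasDerivAt.congr_deriv (HasDerivAt.fun_sum fun i _ => HasDerivAt.fun_sum fun j _ =>
      HasDerivAt.fun_sum fun k _ => HasDerivAt.fun_sum fun m _ =>
        ((((this _ _ _ _).const_mul _).const_mul _).const_mul _).const_mul _) ?_
    simp
end

section
/- Let X = (x_1, …, x_n) and Y = (y_1, …, y_n) be two words of the same length n with letters in ι, and let D_X = D_{x_1}∘⋯∘D_{x_n} and D_Y = D_{y_1}∘⋯∘D_{y_n} be the corresponding compositions of time-delay operators. Then for every continuously differentiable φ : ℝ → ℝ and every t ∈ ℝ, the function F(s) = (([D_X, D_Y])φ)(t) satisfies F(0) = 0 and F′(0) = (Σ_{i=1}^{n} L(x_i) · Σ_{j=1}^{n} ℓ(y_j) − Σ_{j=1}^{n} L(y_j) · Σ_{i=1}^{n} ℓ(x_i)) · φ′(t − Σ_{k=1}^{n} L(x_k) − Σ_{k'=1}^{n} L(y_{k'})). -/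
namespace TDI

theorem wordMap_zero_aux {ι : Type*} (L l : ι → ℝ) (W : List ι) (u : ℝ) :
    wordMap L l 0 (W.map fun i => (i, true)) u = u - (W.map L).sum := by
  induction W generalizing u with
  | nil => simp [wordMap]
  | cons x W ih =>
    simp only [List.map_cons, wordMap, Function.comp_apply, ih, List.sum_cons, letterMap]
    simp only [if_true]
    ring

theorem wordMap_deriv_aux {ι : Type*} (L l : ι → ℝ) (W : List ι) :
    ∃ c : ℝ, ∀ (u : ℝ → ℝ) (u' : ℝ), HasDerivAt u u' 0 →
      HasDerivAt (fun s => wordMap L l s (W.map fun i => (i, true)) (u s))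
        (u' - (W.map l).sum * u 0 + c) 0 := by
  induction W with
  | nil => exact ⟨0, fun u u' h => by simpa [wordMap] using h⟩
  | cons x W ih =>
    obtain ⟨c, hc⟩ := ih
    refine ⟨c + (W.map l).sum * L x, fun u u' h => ?_⟩
    have h1 : HasDerivAt (fun s : ℝ => (1 - s * l x) * u s - L x)
        (-(1 * l x) * u 0 + (1 - 0 * l x) * u') 0 :=
      ((((hasDerivAt_id (0 : ℝ)).mul_const (l x)).const_sub 1).mul h).sub_const (L x)
    have h2 := hc _ _ h1
    simp only [List.map_cons, wordMap, Function.comp_apply, List.sum_cons, letterMap, if_true]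
    convert h2 using 1
    ring

end TDI

/-- **Equation (8).** For two words `X`, `Y` of the same length `n` in the time-delay
operators (all signs positive), the commutator `[D_X, D_Y]` applied to a continuously
differentiable `φ` at `t`, viewed as a function `F` of the expansion parameter `s`,
satisfies `F(0) = 0` and
`F′(0) = (Σᵢ L(xᵢ) · Σⱼ ℓ(yⱼ) − Σⱼ L(yⱼ) · Σᵢ ℓ(xᵢ)) · φ′(t − Σ L(xₖ) − Σ L(yₖ'))`. -/
theorem delay_commutator_first_order (ι : Type*) [Fintype ι] (L l : ι → ℝ)
    (n : ℕ) (X Y : List ι) (hX : X.length = n) (hY : Y.length = n)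
    (φ : ℝ → ℝ) (hφ : ContDiff ℝ 1 φ) (t : ℝ) :
    TDI.comm (TDI.wordOp L l 0 (X.map fun i => (i, true)))
        (TDI.wordOp L l 0 (Y.map fun i => (i, true))) φ t = 0 ∧
      HasDerivAt
        (fun s : ℝ =>
          TDI.comm (TDI.wordOp L l s (X.map fun i => (i, true)))
            (TDI.wordOp L l s (Y.map fun i => (i, true))) φ t)
        (((X.map L).sum * (Y.map l).sum - (Y.map L).sum * (X.map l).sum) *
          deriv φ (t - (X.map L).sum - (Y.map L).sum))
        0 := by
  obtain ⟨c, hc⟩ := TDI.wordMap_deriv_aux L l X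
  obtain ⟨d, hd⟩ := TDI.wordMap_deriv_aux L l Y
  have hdiff : Differentiable ℝ φ := hφ.differentiable (by norm_num)
  simp only [TDI.comm, TDI.wordOp, Function.comp_apply]
  constructor
  · simp only [TDI.wordMap_zero_aux]
    rw [sub_right_comm, sub_self]
  · have h0 := hasDerivAt_const (0 : ℝ) t
    have a := hd _ _ (hc _ _ h0)
    have b := hc _ _ (hd _ _ h0)
    have A := HasDerivAt.comp (0 : ℝ) (hdiff _).hasDerivAt a
    have B := HasDerivAt.comp (0 : ℝ) (hdiff _).hasDerivAt b
    have C := A.sub B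
    simp only [TDI.wordMap_zero_aux] at C
    rw [sub_right_comm t (Y.map L).sum] at C
    refine C.congr_deriv ?_
    ring
end

section
/- Let X = (x_1, …, x_n) and Y = (y_1, …, y_n) be two words of the same length n whose letters x_k = (i_k, δ_{x_k}) and y_k = (j_k, δ_{y_k}) are pairs of an index in ι and a sign δ ∈ {+1, −1} (sign +1 for a time-delay operator, −1 for a time-advance operator), and let D_X = D_{x_1}∘⋯∘D_{x_n} and D_Y = D_{y_1}∘⋯∘D_{y_n} be the corresponding compositions. Write L(x_k) and ℓ(x_k) for the armlength and rate of the index of the letter x_k. Then for every continuously differentiable φ : ℝ → ℝ and every t ∈ ℝ, the function F(s) = (([D_X, D_Y])φ)(t), defined for all s in some neighborhood of 0, satisfies F(0) = 0 and F′(0) = (Σ_{k=1}^{n} δ_{x_k}·L(x_k) · Σ_{k'=1}^{n} δ_{y_{k'}}·ℓ(y_{k'}) − Σ_{k'=1}^{n} δ_{y_{k'}}·L(y_{k'}) · Σ_{k=1}^{n} δ_{x_k}·ℓ(x_k)) · φ′(t − Σ_{k=1}^{n} δ_{x_k}·L(x_k) − Σ_{k'=1}^{n} δ_{y_{k'}}·L(y_{k'})).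 -/
namespace TDI

/-- The sign of a letter: `+1` for a time-delay operator, `−1` for a time-advance
operator. -/
def sgn (b : Bool) : ℝ := if b then 1 else -1

end TDI

theorem TDI.wordMap_zero {ι : Type*} (L l : ι → ℝ) (w : TDI.Word ι) : ∀ a : ℝ,
    TDI.wordMap L l 0 w a = a - (w.map fun x => TDI.sgn x.2 * L x.1).sum := by
  induction w with
  | nil => intro a; simp [TDI.wordMap]
  | cons x w ih =>
    intro a
    rcases x with ⟨i, b⟩
    cases b <;> simp [TDI.wordMap, TDI.letterMap, TDI.sgn, ih] <;> ring

theorem TDI.wordMap_deriv_s6 {ι : Type*} (L l : ι → ℝ) (w : TDI.Word ι) :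
    ∃ K : ℝ, ∀ (f : ℝ → ℝ) (f' : ℝ), HasDerivAt f f' 0 →
      HasDerivAt (fun s => TDI.wordMap L l s w (f s))
        (f' + K - f 0 * (w.map fun x => TDI.sgn x.2 * l x.1).sum) 0 := by
  induction w with
  | nil => exact ⟨0, fun f f' h => by simpa [TDI.wordMap] using h⟩
  | cons x w ih =>
    obtain ⟨K, hK⟩ := ih
    rcases x with ⟨i, b⟩
    have h1 : HasDerivAt (fun s : ℝ => 1 - s * l i) (-(l i)) 0 := by
      simpa using ((hasDerivAt_id (0 : ℝ)).mul_const (l i)).const_sub 1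
    cases b
    · refine ⟨K + l i * L i - L i * (w.map fun x => TDI.sgn x.2 * l x.1).sum, fun f f' h => ?_⟩
      have h2 := hK _ _ ((h.add_const (L i)).div h1 (by simp))
      simp only [TDI.wordMap, TDI.letterMap, TDI.sgn, Function.comp] at h2 ⊢
      refine h2.congr_deriv ?_
      simp
      ring
    · refine ⟨K + L i * (w.map fun x => TDI.sgn x.2 * l x.1).sum, fun f f' h => ?_⟩
      have h2 := hK _ _ ((h1.mul h).sub_const (L i))
      simp only [TDI.wordMap, TDI.letterMap, TDI.sgn, Function.comp] at h2 ⊢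
      refine h2.congr_deriv ?_
      simp
      ring

/-- **Equation (A2).** For two signed words `X`, `Y` of the same length `n` in the
time-delay and time-advance operators, the commutator `[D_X, D_Y]` applied to a
continuously differentiable `φ` at `t`, viewed as a function `F` of the expansion
parameter `s`, satisfies `F(0) = 0` and
`F′(0) = (Σₖ δ_{xₖ}L(xₖ) · Σₖ' δ_{yₖ'}ℓ(yₖ') − Σₖ' δ_{yₖ'}L(yₖ') · Σₖ δ_{xₖ}ℓ(xₖ)) ·
φ′(t − Σₖ δ_{xₖ}L(xₖ) − Σₖ' δ_{yₖ'}L(yₖ'))`. -/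
theorem signed_commutator_first_order (ι : Type*) [Fintype ι] (L l : ι → ℝ)
    (n : ℕ) (X Y : TDI.Word ι) (hX : X.length = n) (hY : Y.length = n)
    (φ : ℝ → ℝ) (hφ : ContDiff ℝ 1 φ) (t : ℝ) :
    TDI.comm (TDI.wordOp L l 0 X) (TDI.wordOp L l 0 Y) φ t = 0 ∧
      HasDerivAt
        (fun s : ℝ => TDI.comm (TDI.wordOp L l s X) (TDI.wordOp L l s Y) φ t)
        (((X.map fun x => TDI.sgn x.2 * L x.1).sum *
            (Y.map fun y => TDI.sgn y.2 * l y.1).sum -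
          (Y.map fun y => TDI.sgn y.2 * L y.1).sum *
            (X.map fun x => TDI.sgn x.2 * l x.1).sum) *
          deriv φ (t - (X.map fun x => TDI.sgn x.2 * L x.1).sum -
            (Y.map fun y => TDI.sgn y.2 * L y.1).sum))
        0 := by
  have hd : ∀ a, HasDerivAt φ (deriv φ a) a := fun a =>
    ((hφ.differentiable (by norm_num)) a).hasDerivAt
  obtain ⟨K, hK⟩ := TDI.wordMap_deriv_s6 L l X
  obtain ⟨M, hM⟩ := TDI.wordMap_deriv_s6 L l Y
  simp only [TDI.comm, TDI.wordOp, Function.comp]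
  constructor
  · simp only [TDI.wordMap_zero]
    rw [sub_right_comm, sub_self]
  · have hc := hasDerivAt_const (0 : ℝ) t
    have h1 := HasDerivAt.comp (0 : ℝ) (hd _) (hM _ _ (hK _ _ hc))
    have h2 := HasDerivAt.comp (0 : ℝ) (hd _) (hK _ _ (hM _ _ hc))
    refine (h1.sub h2).congr_deriv ?_
    simp only [TDI.wordMap_zero]
    rw [sub_right_comm t (List.sum (Y.map _))]
    ring
end

section
/- Let X = (x_1, …, x_n) be a word whose letters are pairs (i, ε) of an index in ι and a sign ε ∈ {+1, −1} (sign +1 for a time-delay operator, −1 for a time-advance operator), let π be a permutation of {1, …, n}, and let Y = (x_{π(1)}, …, x_{π(n)}) be the permuted word. Let D_X and D_Y be the corresponding compositions of time-delay and time-advance operators. Then the commutator [D_X, D_Y] vanishes to first order in the rates: for every continuously differentiable φ : ℝ → ℝ and every t ∈ ℝ, the function F(s) = (([D_X, D_Y])φ)(t), defined for all s in some neighborhood of 0, satisfies F(0) = 0 and F′(0) = 0. -/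
namespace TDI

noncomputable def slopeAux {ι : Type*} (l : ι → ℝ) (s : ℝ) (x : Letter ι) : ℝ :=
  if x.2 then 1 - s * l x.1 else (1 - s * l x.1)⁻¹

theorem wordMap_affine {ι : Type*} (L l : ι → ℝ) (s : ℝ) (w : Word ι) (t : ℝ) :
    wordMap L l s w t = (w.map (slopeAux l s)).prod * t + wordMap L l s w 0 := by
  induction w generalizing t with
  | nil => simp [wordMap]
  | cons x w ih =>
    simp only [wordMap, Function.comp, List.map_cons, List.prod_cons]
    rw [ih (letterMap L l s x t), ih (letterMap L l s x 0)]
    have : letterMap L l s x t = slopeAux l s x * t + letterMap L l s x 0 := by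
      unfold letterMap slopeAux
      split_ifs <;> ring
    rw [this]; ring

theorem wordMap_zero_s7 {ι : Type*} (L l : ι → ℝ) (w : Word ι) (t : ℝ) :
    wordMap L l 0 w t = t + (w.map fun x => if x.2 then - L x.1 else L x.1).sum := by
  induction w generalizing t with
  | nil => simp [wordMap]
  | cons x w ih =>
    simp only [wordMap, Function.comp, List.map_cons, List.sum_cons]
    rw [ih]
    unfold letterMap
    split_ifs <;> simp <;> ring

theorem wordMap_diff {ι : Type*} (L l : ι → ℝ) (w : Word ι) (f : ℝ → ℝ)
    (hf : DifferentiableAt ℝ f 0) :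
    DifferentiableAt ℝ (fun s => wordMap L l s w (f s)) 0 := by
  induction w generalizing f with
  | nil => simpa [wordMap] using hf
  | cons x w ih =>
    simp only [wordMap, Function.comp]
    apply ih
    unfold letterMap
    split_ifs
    · fun_prop
    · apply DifferentiableAt.div
      · fun_prop
      · fun_prop
      · simp

theorem slope_diff {ι : Type*} (L l : ι → ℝ) (w : Word ι) :
    DifferentiableAt ℝ (fun s => (w.map (slopeAux l s)).prod) 0 := by
  have h : (fun s => (w.map (slopeAux l s)).prod)
      = fun s => wordMap L l s w 1 - wordMap L l s w 0 := by
    funext s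
    rw [wordMap_affine L l s w 1]; ring
  rw [h]
  exact (wordMap_diff L l w (fun _ => 1) (by fun_prop)).sub
    (wordMap_diff L l w (fun _ => 0) (by fun_prop))

theorem comm_perm {ι : Type*} (L l : ι → ℝ) (X Y : Word ι) (hp : Y.Perm X)
    (φ : ℝ → ℝ) (hφ : ContDiff ℝ 1 φ) (t : ℝ) :
    comm (wordOp L l 0 X) (wordOp L l 0 Y) φ t = 0 ∧
    HasDerivAt (fun s => comm (wordOp L l s X) (wordOp L l s Y) φ t) 0 0 := by
  have hB : ∀ t, wordMap L l 0 Y t = wordMap L l 0 X t := fun t => by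
    rw [wordMap_zero_s7, wordMap_zero_s7, (hp.map _).sum_eq]
  have huv0 : wordMap L l 0 Y (wordMap L l 0 X t) = wordMap L l 0 X (wordMap L l 0 Y t) := by
    rw [hB, hB]
  have hA0 : (X.map (slopeAux l 0)).prod = 1 := by
    have h1 := wordMap_affine L l 0 X 1
    rw [wordMap_zero_s7, wordMap_zero_s7] at h1
    linarith
  have hX := wordMap_diff L l X (fun _ => t) (by fun_prop)
  have hY := wordMap_diff L l Y (fun _ => t) (by fun_prop)
  have hu := (wordMap_diff L l Y _ hX).hasDerivAt
  have hv := (wordMap_diff L l X _ hY).hasDerivAt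
  have hX0 := (wordMap_diff L l X (fun _ => 0) (by fun_prop)).hasDerivAt
  have hY0 := (wordMap_diff L l Y (fun _ => 0) (by fun_prop)).hasDerivAt
  have hA := (slope_diff L l X).hasDerivAt
  have hprod := (hA.sub_const 1).mul (hX0.sub hY0)
  have heq : (fun s => wordMap L l s Y (wordMap L l s X t)) - 
      (fun s => wordMap L l s X (wordMap L l s Y t)) =
      (fun s => (X.map (slopeAux l s)).prod - 1) *
        ((fun s => wordMap L l s X 0) - fun s => wordMap L l s Y 0) := by
    funext s
    simp only [Pi.sub_apply, Pi.mul_apply]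
    rw [wordMap_affine L l s Y (wordMap L l s X t), wordMap_affine L l s X (wordMap L l s Y t),
      wordMap_affine L l s X t, wordMap_affine L l s Y t, (hp.map _).prod_eq]
    ring
  have hd := hu.sub hv
  rw [heq] at hd
  have hdd := hd.unique hprod
  simp only [Pi.sub_apply, hA0, hB, sub_self, mul_zero, zero_mul, add_zero] at hdd
  have hφd : ∀ x, HasDerivAt φ (deriv φ x) x := fun x =>
    (hφ.differentiable (by norm_num) x).hasDerivAt
  refine ⟨?_, ?_⟩
  · simp [comm, wordOp, huv0]
  · have h1 := (hφd _).comp (0 : ℝ) hu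
    have h2 := (hφd _).comp (0 : ℝ) hv
    have h3 := h1.sub h2
    rw [huv0, ← mul_sub, hdd, mul_zero] at h3
    exact h3

end TDI

/-- **Vanishing condition (Eq. (9)).** If `Y` is obtained from the signed word
`X = (x₁, …, xₙ)` by a permutation `π`, i.e. `Y = (x_{π(1)}, …, x_{π(n)})`, then the
commutator `[D_X, D_Y]` vanishes to first order in the rates: for every continuously
differentiable `φ` and every `t`, the function `F(s) = (([D_X, D_Y])φ)(t)` satisfies
`F(0) = 0` and `F′(0) = 0`. -/
theorem permuted_commutator_vanishes (ι : Type*) [Fintype ι] (L l : ι → ℝ)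
    (n : ℕ) (X : Fin n → TDI.Letter ι) (π : Equiv.Perm (Fin n))
    (φ : ℝ → ℝ) (hφ : ContDiff ℝ 1 φ) (t : ℝ) :
    TDI.comm (TDI.wordOp L l 0 (List.ofFn X))
        (TDI.wordOp L l 0 (List.ofFn (fun k => X (π k)))) φ t = 0 ∧
      HasDerivAt
        (fun s : ℝ =>
          TDI.comm (TDI.wordOp L l s (List.ofFn X))
            (TDI.wordOp L l s (List.ofFn (fun k => X (π k)))) φ t)
        0 0 := by
  exact TDI.comm_perm L l _ _ (Equiv.Perm.ofFn_comp_perm π X) φ hφ t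
end

section
/- For any two elements A, B ∈ R, the commutator [A, B] = A*B − B*A lies in the ℤ-submodule of R spanned by the elements u*(v*w − w*v)*z, where u, z ∈ M are arbitrary words and v, w ∈ M are words of equal length (|v| = |w|). In particular, the commutator of any two monomials (words) p, q ∈ M can be written as a finite sum of left and right monomial multiples of commutators of equal-length monomials. -/
theorem perm_aux (X : Type*) (S : Submodule ℤ (MonoidAlgebra ℤ (FreeMonoid X)))
    (hS : ∀ u v w z : FreeMonoid X, v.length = w.length →
      MonoidAlgebra.of ℤ (FreeMonoid X) u *
                (MonoidAlgebra.of ℤ (FreeMonoid X) v * MonoidAlgebra.of ℤ (FreeMonoid X) w -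
                  MonoidAlgebra.of ℤ (FreeMonoid X) w * MonoidAlgebra.of ℤ (FreeMonoid X) v) *
                MonoidAlgebra.of ℤ (FreeMonoid X) z ∈ S)
    (l l' : List X) (h : l.Perm l') : ∀ u : FreeMonoid X,
      MonoidAlgebra.of ℤ (FreeMonoid X) (u * FreeMonoid.ofList l) -
        MonoidAlgebra.of ℤ (FreeMonoid X) (u * FreeMonoid.ofList l') ∈ S := by
  induction h with
  | nil => intro u; rw [sub_self]; exact S.zero_mem
  | cons x _ ih =>
    intro u
    have := ih (u * FreeMonoid.of x)
    simpa only [FreeMonoid.ofList_cons, mul_assoc] using this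
  | swap x y l =>
    intro u
    have := hS u (FreeMonoid.of y) (FreeMonoid.of x) (FreeMonoid.ofList l) rfl
    simpa only [FreeMonoid.ofList_cons, map_mul, mul_sub, sub_mul, mul_assoc] using this
  | trans _ _ ih1 ih2 =>
    intro u
    have := S.add_mem (ih1 u) (ih2 u)
    rwa [sub_add_sub_cancel] at this


/-- **Equation (A6).** In the monoid algebra `R = MonoidAlgebra ℤ (FreeMonoid X)` of
noncommutative polynomials in the letters of `X`, the commutator `[A, B] = A*B − B*A` of
any two elements lies in the ℤ-submodule spanned by the elements
`u * (v*w − w*v) * z` where `u, z` are arbitrary words and `v, w` are words of equal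
length. -/
theorem commutator_mem_span_equal_length (X : Type*)
    (A B : MonoidAlgebra ℤ (FreeMonoid X)) :
    A * B - B * A ∈ Submodule.span ℤ
      {r : MonoidAlgebra ℤ (FreeMonoid X) |
        ∃ u v w z : FreeMonoid X, v.length = w.length ∧
          r = MonoidAlgebra.of ℤ (FreeMonoid X) u *
                (MonoidAlgebra.of ℤ (FreeMonoid X) v * MonoidAlgebra.of ℤ (FreeMonoid X) w -
                  MonoidAlgebra.of ℤ (FreeMonoid X) w * MonoidAlgebra.of ℤ (FreeMonoid X) v) *
                MonoidAlgebra.of ℤ (FreeMonoid X) z} := by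
  generalize hSd : Submodule.span ℤ (_ : Set (MonoidAlgebra ℤ (FreeMonoid X))) = S
  have hS := perm_aux X S (by
    intro u v w z h
    rw [← hSd]
    exact Submodule.subset_span ⟨u, v, w, z, h, rfl⟩)
  clear hSd
  induction A using MonoidAlgebra.induction_on with
  | of p =>
    induction B using MonoidAlgebra.induction_on with
    | of q =>
      have := hS (p.toList ++ q.toList) (q.toList ++ p.toList) List.perm_append_comm 1
      rw [one_mul, one_mul, FreeMonoid.ofList_append, FreeMonoid.ofList_append] at this
      simpa only [map_mul, FreeMonoid.ofList_toList] using this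
    | add f g hf hg =>
      have := S.add_mem hf hg
      rwa [sub_add_sub_comm, ← mul_add, ← add_mul] at this
    | smul r f hf =>
      have := S.smul_mem r hf
      rwa [smul_sub, ← mul_smul_comm, ← smul_mul_assoc] at this
  | add f g hf hg =>
    have := S.add_mem hf hg
    rwa [sub_add_sub_comm, ← mul_add, ← add_mul] at this
  | smul r f hf =>
    have := S.smul_mem r hf
    rwa [smul_sub, ← smul_mul_assoc, ← mul_smul_comm] at this
end

section
/- For all A, B, C, D ∈ R: there exist λ, γ ∈ R such that [C, [A, B]] = λ*(1 − a) + γ*(1 − b), and there exist λ′, γ′ ∈ R such that [C, D]*[A, B] = λ′*(1 − a) + γ′*(1 − b). That is, every commutator constructed as in Propositions 1 and 2 can be written as a sum of left multipliers of (1 − a) and (1 − b), so that the corresponding TDI coefficients exist. -/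
theorem aux_decomp (x : MonoidAlgebra ℤ (FreeGroup (Fin 2))) :
    ∃ (n : ℤ) (l g : MonoidAlgebra ℤ (FreeGroup (Fin 2))),
      x = (n : MonoidAlgebra ℤ (FreeGroup (Fin 2))) +
        (l * (1 - MonoidAlgebra.of ℤ (FreeGroup (Fin 2)) (FreeGroup.of 0)) +
            g * (1 - MonoidAlgebra.of ℤ (FreeGroup (Fin 2)) (FreeGroup.of 1))) := by
  induction x using MonoidAlgebra.induction_on with
  | of w =>
    induction w using FreeGroup.induction_on with
    | C1 => exact ⟨1, 0, 0, by rw [map_one]; simp⟩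
    | of i =>
      fin_cases i
      · exact ⟨1, -1, 0, by simp⟩
      · exact ⟨1, 0, -1, by simp⟩
    | inv_of i _ =>
      have key : ∀ u : FreeGroup (Fin 2), MonoidAlgebra.of ℤ (FreeGroup (Fin 2)) u⁻¹ =
          ((1 : ℤ) : MonoidAlgebra ℤ (FreeGroup (Fin 2))) +
          MonoidAlgebra.of ℤ (FreeGroup (Fin 2)) u⁻¹ *
            (1 - MonoidAlgebra.of ℤ (FreeGroup (Fin 2)) u) := by
        intro u
        rw [mul_sub, ← map_mul, inv_mul_cancel, map_one, Int.cast_one, mul_one]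
        abel
      fin_cases i
      · refine ⟨1, MonoidAlgebra.of ℤ _ (FreeGroup.of 0)⁻¹, 0, (key (FreeGroup.of 0)).trans ?_⟩
        rw [zero_mul, add_zero]
      · refine ⟨1, 0, MonoidAlgebra.of ℤ _ (FreeGroup.of 1)⁻¹, (key (FreeGroup.of 1)).trans ?_⟩
        rw [zero_mul, zero_add]
    | mul u v hu hv =>
      obtain ⟨n, l, g, h⟩ := hu
      obtain ⟨m, l', g', h'⟩ := hv
      refine ⟨n * m, m * l + MonoidAlgebra.of ℤ _ u * l',
        m * g + MonoidAlgebra.of ℤ _ u * g', ?_⟩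
      rw [map_mul]
      generalize MonoidAlgebra.of ℤ (FreeGroup (Fin 2)) u = x at *
      generalize MonoidAlgebra.of ℤ (FreeGroup (Fin 2)) v = y at *
      have e : x * y = m * x + x * (y - m) := by
        rw [mul_sub, (Int.cast_commute m x).eq]; abel
      rw [e, sub_eq_of_eq_add' h']
      nth_rewrite 1 [h]
      push_cast
      rw [(Int.cast_commute n (m : MonoidAlgebra ℤ (FreeGroup (Fin 2)))).eq]
      noncomm_ring
  | add x y hx hy =>
    obtain ⟨n, l, g, h⟩ := hx
    obtain ⟨m, l', g', h'⟩ := hy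
    refine ⟨n + m, l + l', g + g', ?_⟩
    rw [h, h']; push_cast; noncomm_ring
  | smul r x hx =>
    obtain ⟨n, l, g, h⟩ := hx
    refine ⟨r * n, r * l, r * g, ?_⟩
    rw [h, zsmul_eq_mul]; push_cast; noncomm_ring

theorem aux_comm (x y : MonoidAlgebra ℤ (FreeGroup (Fin 2))) :
    ∃ (l g : MonoidAlgebra ℤ (FreeGroup (Fin 2))),
      x * y - y * x =
        l * (1 - MonoidAlgebra.of ℤ (FreeGroup (Fin 2)) (FreeGroup.of 0)) +
            g * (1 - MonoidAlgebra.of ℤ (FreeGroup (Fin 2)) (FreeGroup.of 1)) := by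
  obtain ⟨n, l, g, h⟩ := aux_decomp x
  obtain ⟨m, l', g', h'⟩ := aux_decomp y
  refine ⟨(x - n) * l' - (y - m) * l, (x - n) * g' - (y - m) * g, ?_⟩
  have e : x * y - y * x = (x - n) * (y - m) - (y - m) * (x - n) := by
    simp only [mul_sub, sub_mul]
    rw [(Int.cast_commute n (m : MonoidAlgebra ℤ (FreeGroup (Fin 2)))).eq,
      (Int.cast_commute n y).eq, (Int.cast_commute m x).eq]
    abel
  have h1 := sub_eq_of_eq_add' h
  have h2 := sub_eq_of_eq_add' h'
  rw [e]
  generalize x - n = X at *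
  generalize y - m = Y at *
  calc X * Y - Y * X = X * (l' * _ + g' * _) - Y * (l * _ + g * _) := by rw [← h1, ← h2]
    _ = _ := by noncomm_ring


/-- **Proposition 3.** In the integral group ring `R = MonoidAlgebra ℤ F` of the free
group `F` on two generators `a = FreeGroup.of 0` and `b = FreeGroup.of 1`, for all
`A, B, C, D ∈ R` there exist `λ, γ ∈ R` with
`[C, [A, B]] = λ*(1 − a) + γ*(1 − b)`, and there exist `λ′, γ′ ∈ R` with
`[C, D]*[A, B] = λ′*(1 − a) + γ′*(1 − b)`. -/
theorem proposition3 (A B C D : MonoidAlgebra ℤ (FreeGroup (Fin 2))) :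
    (∃ lam gam : MonoidAlgebra ℤ (FreeGroup (Fin 2)),
        C * (A * B - B * A) - (A * B - B * A) * C =
          lam * (1 - MonoidAlgebra.of ℤ (FreeGroup (Fin 2)) (FreeGroup.of 0)) +
            gam * (1 - MonoidAlgebra.of ℤ (FreeGroup (Fin 2)) (FreeGroup.of 1))) ∧
      (∃ lam' gam' : MonoidAlgebra ℤ (FreeGroup (Fin 2)),
        (C * D - D * C) * (A * B - B * A) =
          lam' * (1 - MonoidAlgebra.of ℤ (FreeGroup (Fin 2)) (FreeGroup.of 0)) +
            gam' * (1 - MonoidAlgebra.of ℤ (FreeGroup (Fin 2)) (FreeGroup.of 1))) := by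
  refine ⟨aux_comm _ _, ?_⟩
  obtain ⟨l, g, h⟩ := aux_comm A B
  refine ⟨(C * D - D * C) * l, (C * D - D * C) * g, ?_⟩
  rw [h, mul_add, mul_assoc, mul_assoc]
end

section
/- (Monitor reduction.) Let q2, q3' ∈ R be arbitrary and set q3 := 0, q2' := 0, q1 := (q2 − q3'*D1')*D3⁻¹, q1' := −q1. Then the first and second TDI equations hold identically, and the tuple (q1, q2, q3, q1', q2', q3') satisfies all three TDI equations if and only if q2*(D3⁻¹ − D1*D2'⁻¹) + q3'*(D2'⁻¹ − D1'*D3⁻¹) = 0. -/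
noncomputable section

namespace TDIMonitor

/-- The free group on the six time-delay operators (inverses model time-advance). -/
abbrev F : Type := FreeGroup (Fin 6)

/-- The integral group ring. -/
abbrev R : Type := MonoidAlgebra ℤ F

def D1 : R := MonoidAlgebra.of ℤ F (FreeGroup.of 0)
def D2 : R := MonoidAlgebra.of ℤ F (FreeGroup.of 1)
def D3 : R := MonoidAlgebra.of ℤ F (FreeGroup.of 2)
def D1' : R := MonoidAlgebra.of ℤ F (FreeGroup.of 3)
def D2' : R := MonoidAlgebra.of ℤ F (FreeGroup.of 4)
def D3' : R := MonoidAlgebra.of ℤ F (FreeGroup.of 5)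

/-- The time-advance operators: images of the inverse group elements. -/
def D1inv : R := MonoidAlgebra.of ℤ F (FreeGroup.of 0)⁻¹
def D3inv : R := MonoidAlgebra.of ℤ F (FreeGroup.of 2)⁻¹
def D1'inv : R := MonoidAlgebra.of ℤ F (FreeGroup.of 3)⁻¹
def D2'inv : R := MonoidAlgebra.of ℤ F (FreeGroup.of 4)⁻¹

lemma of_inv_mul (g : F) : MonoidAlgebra.of ℤ F g⁻¹ * MonoidAlgebra.of ℤ F g = 1 := by
  rw [← map_mul, inv_mul_cancel, map_one]

lemma of_mul_inv (g : F) : MonoidAlgebra.of ℤ F g * MonoidAlgebra.of ℤ F g⁻¹ = 1 := by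
  rw [← map_mul, mul_inv_cancel, map_one]

/-- **Monitor reduction.** With `q3 := 0`, `q2' := 0`, `q1 := (q2 − q3'*D1')*D3⁻¹`,
`q1' := −q1`, the first and second TDI equations hold identically, and the tuple
satisfies all three TDI equations iff
`q2*(D3⁻¹ − D1*D2'⁻¹) + q3'*(D2'⁻¹ − D1'*D3⁻¹) = 0`. -/
theorem monitor_reduction (q1 q1' q2 q3 q2' q3' : R)
    (hq3 : q3 = 0) (hq2' : q2' = 0)
    (hq1 : q1 = (q2 - q3' * D1') * D3inv) (hq1' : q1' = -q1) :
    (q1 + q1' - q2' * D3' - q3 * D2 = 0 ∧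
        q2 + q2' - q3' * D1' - q1 * D3 = 0) ∧
      ((q1 + q1' - q2' * D3' - q3 * D2 = 0 ∧
          q2 + q2' - q3' * D1' - q1 * D3 = 0 ∧
          q3 + q3' - q1' * D2' - q2 * D1 = 0) ↔
        q2 * (D3inv - D1 * D2'inv) + q3' * (D2'inv - D1' * D3inv) = 0) := by
  have h3 : D3inv * D3 = 1 := of_inv_mul _
  have h2 : D2'inv * D2' = 1 := of_inv_mul _
  have h2r : D2' * D2'inv = 1 := of_mul_inv _
  have e1 : q1 + q1' - q2' * D3' - q3 * D2 = 0 := by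
    rw [hq1', hq2', hq3, zero_mul, zero_mul, sub_zero, sub_zero, add_neg_cancel]
  have e2 : q2 + q2' - q3' * D1' - q1 * D3 = 0 := by
    rw [hq1, hq2', mul_assoc, h3, mul_one, add_zero, sub_self]
  have key : q2 * (D3inv - D1 * D2'inv) + q3' * (D2'inv - D1' * D3inv)
      = (q3 + q3' - q1' * D2' - q2 * D1) * D2'inv := by
    have : (q3 + q3' - q1' * D2' - q2 * D1) * D2'inv
        = q3 * D2'inv + q3' * D2'inv - q1' * (D2' * D2'inv) - q2 * D1 * D2'inv := by
      simp only [sub_mul, add_mul, mul_assoc]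
    rw [this, h2r, hq1', hq1, hq3]
    simp only [sub_mul, mul_sub, mul_assoc, zero_mul, mul_one]
    abel
  refine ⟨⟨e1, e2⟩, ?_⟩
  rw [key]
  constructor
  · rintro ⟨-, -, h⟩
    rw [h, zero_mul]
  · intro h
    refine ⟨e1, e2, ?_⟩
    have h' := congrArg (fun x => x * D2') h
    simpa only [mul_assoc, h2, mul_one, zero_mul] using h'

end TDIMonitor
end
end

section
/- (Relay reduction.) Let q2', q3' ∈ R be arbitrary and set q2 := 0, q3 := 0, q1 := (q2' − q3'*D1')*D3⁻¹, q1' := q3'*D2'⁻¹. Then the second and third TDI equations hold identically, and the tuple (q1, q2, q3, q1', q2', q3') satisfies all three TDI equations if and only if q2'*(D3⁻¹ − D3') + q3'*(D2'⁻¹ − D1'*D3⁻¹) = 0. -/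
noncomputable section

namespace TDIRelay

/-- The free group on the six time-delay operators (inverses model time-advance). -/
abbrev F : Type := FreeGroup (Fin 6)

/-- The integral group ring. -/
abbrev R : Type := MonoidAlgebra ℤ F

def D1 : R := MonoidAlgebra.of ℤ F (FreeGroup.of 0)
def D2 : R := MonoidAlgebra.of ℤ F (FreeGroup.of 1)
def D3 : R := MonoidAlgebra.of ℤ F (FreeGroup.of 2)
def D1' : R := MonoidAlgebra.of ℤ F (FreeGroup.of 3)
def D2' : R := MonoidAlgebra.of ℤ F (FreeGroup.of 4)
def D3' : R := MonoidAlgebra.of ℤ F (FreeGroup.of 5)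

/-- The time-advance operators: images of the inverse group elements. -/
def D1inv : R := MonoidAlgebra.of ℤ F (FreeGroup.of 0)⁻¹
def D3inv : R := MonoidAlgebra.of ℤ F (FreeGroup.of 2)⁻¹
def D1'inv : R := MonoidAlgebra.of ℤ F (FreeGroup.of 3)⁻¹
def D2'inv : R := MonoidAlgebra.of ℤ F (FreeGroup.of 4)⁻¹

theorem D3inv_mul : D3inv * D3 = 1 := by
  unfold D3inv D3
  rw [← map_mul, inv_mul_cancel, map_one]

theorem D2'inv_mul : D2'inv * D2' = 1 := by
  unfold D2'inv D2'
  rw [← map_mul, inv_mul_cancel, map_one]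

/-- **Relay reduction.** With `q2 := 0`, `q3 := 0`, `q1 := (q2' − q3'*D1')*D3⁻¹`,
`q1' := q3'*D2'⁻¹`, the second and third TDI equations hold identically, and the tuple
satisfies all three TDI equations iff
`q2'*(D3⁻¹ − D3') + q3'*(D2'⁻¹ − D1'*D3⁻¹) = 0`. -/
theorem relay_reduction (q1 q1' q2 q3 q2' q3' : R)
    (hq2 : q2 = 0) (hq3 : q3 = 0)
    (hq1 : q1 = (q2' - q3' * D1') * D3inv) (hq1' : q1' = q3' * D2'inv) :
    (q2 + q2' - q3' * D1' - q1 * D3 = 0 ∧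
        q3 + q3' - q1' * D2' - q2 * D1 = 0) ∧
      ((q1 + q1' - q2' * D3' - q3 * D2 = 0 ∧
          q2 + q2' - q3' * D1' - q1 * D3 = 0 ∧
          q3 + q3' - q1' * D2' - q2 * D1 = 0) ↔
        q2' * (D3inv - D3') + q3' * (D2'inv - D1' * D3inv) = 0) := by
  subst hq2 hq3 hq1 hq1'
  have h2 : 0 + q2' - q3' * D1' - (q2' - q3' * D1') * D3inv * D3 = 0 := by
    rw [mul_assoc _ D3inv D3, D3inv_mul, mul_one, zero_add, sub_self]
  have h3 : 0 + q3' - q3' * D2'inv * D2' - 0 * D1 = 0 := by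
    rw [mul_assoc _ D2'inv D2', D2'inv_mul, mul_one, zero_add, zero_mul, sub_self, sub_zero]
  have h1 : (q2' - q3' * D1') * D3inv + q3' * D2'inv - q2' * D3' - 0 * D2
      = q2' * (D3inv - D3') + q3' * (D2'inv - D1' * D3inv) := by
    noncomm_ring
  refine ⟨⟨h2, h3⟩, ?_⟩
  rw [h1]
  exact ⟨fun h => h.1, fun h => ⟨h, h2, h3⟩⟩

end TDIRelay
end
end
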